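/- Let d > 0 and ν ∈ ℝ be such that none of ν, ν + d/2, ν + d, 2ν + d is a negative integer. Then the triple series defining J_ν^{[3,1]}(t₁,t₂,t₃) converges absolutely for every (t₁,t₂,t₃) ∈ ℝ³; i.e., Σ_{m₁,m₂,m₃≥0} | (1+2ν+d)_{m₁+2m₂+4m₃} t₁^{m₁} t₂^{m₂} t₃^{m₃} / [(1)_{m₁}(1)_{m₂}(1)_{m₃}(1+ν)_{m₃}(1+ν+d/2)_{m₂+2m₃}(1+ν+d)_{m₁+2m₂+3m₃}(1+2ν+d)_{m₁+2m₂+3m₃}] | < ∞. -/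

import Mathlib

open MeasureTheory Real Matrix

noncomputable def poch (a : ℝ) (k : ℕ) : ℝ := ∏ i ∈ Finset.range k, (a + i)

def sym3 (a b : Fin 3 → ℝ) : Matrix (Fin 3) (Fin 3) ℝ :=
  !![a 0, b 0, b 1;
     b 0, a 1, b 2;
     b 1, b 2, a 2]

noncomputable def K3 (ν : ℝ) (x : Matrix (Fin 3) (Fin 3) ℝ) : ℝ :=
  (Real.sqrt 2) ^ 3 *
    ∫ p in {p : (Fin 3 → ℝ) × (Fin 3 → ℝ) | (sym3 p.1 p.2).PosDef},
      Real.exp (-(sym3 p.1 p.2)⁻¹.trace - (x * sym3 p.1 p.2).trace) *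
        (sym3 p.1 p.2).det ^ (ν - 2)

def sym2 (a : Fin 2 → ℝ) (b : ℝ) : Matrix (Fin 2) (Fin 2) ℝ := !![a 0, b; b, a 1]

noncomputable def K2 (μ : ℝ) (x : Matrix (Fin 2) (Fin 2) ℝ) : ℝ :=
  Real.sqrt 2 *
    ∫ p in {p : (Fin 2 → ℝ) × ℝ | (sym2 p.1 p.2).PosDef},
      Real.exp (-(sym2 p.1 p.2)⁻¹.trace - (x * sym2 p.1 p.2).trace) *
        (sym2 p.1 p.2).det ^ (μ - 3/2)

noncomputable def J31 (d ν t₁ t₂ t₃ : ℝ) : ℝ :=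
  ∑' m : ℕ × ℕ × ℕ,
    ((-1 : ℝ) ^ (m.1 + m.2.2) * poch (1 + 2*ν + d) (m.1 + 2*m.2.1 + 4*m.2.2)
        * t₁ ^ m.1 * t₂ ^ m.2.1 * t₃ ^ m.2.2) /
      (poch 1 m.1 * poch 1 m.2.1 * poch 1 m.2.2 * poch (1 + ν) m.2.2
        * poch (1 + ν + d/2) (m.2.1 + 2*m.2.2)
        * poch (1 + ν + d) (m.1 + 2*m.2.1 + 3*m.2.2)
        * poch (1 + 2*ν + d) (m.1 + 2*m.2.1 + 3*m.2.2))

noncomputable def J32 (d ν t₁ t₂ t₃ : ℝ) : ℝ :=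
  ∑' m : ℕ × ℕ × ℕ,
    ((-1 : ℝ) ^ (m.1 + m.2.2) * poch (1 + ν) (m.1 + 2*m.2.1 + 4*m.2.2)
        * t₁ ^ ((m.1 : ℝ) - ν - d) * t₂ ^ m.2.1 * t₃ ^ m.2.2) /
      (poch (1 - ν - d) m.1 * poch 1 m.2.1 * poch 1 m.2.2 * poch (1 + ν) m.2.2
        * poch (1 + ν + d/2) (m.2.1 + 2*m.2.2)
        * poch 1 (m.1 + 2*m.2.1 + 3*m.2.2)
        * poch (1 + ν) (m.1 + 2*m.2.1 + 3*m.2.2))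

noncomputable def J33 (d ν t₁ t₂ t₃ : ℝ) : ℝ :=
  ∑' m : ℕ × ℕ × ℕ,
    ((-1 : ℝ) ^ (m.1 + m.2.2) * poch 1 (m.1 + 2*m.2.1 + 4*m.2.2)
        * t₁ ^ m.1 * t₂ ^ ((m.2.1 : ℝ) - ν - d/2) * t₃ ^ m.2.2) /
      (poch 1 m.1 * poch (1 - ν - d/2) m.2.1 * poch 1 m.2.2 * poch (1 + ν) m.2.2
        * poch 1 (m.2.1 + 2*m.2.2)
        * poch (1 - ν) (m.1 + 2*m.2.1 + 3*m.2.2)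
        * poch 1 (m.1 + 2*m.2.1 + 3*m.2.2))

noncomputable def J34 (d ν t₁ t₂ t₃ : ℝ) : ℝ :=
  ∑' m : ℕ × ℕ × ℕ,
    ((-1 : ℝ) ^ (m.1 + m.2.2) * poch (1 + ν) (m.1 + 2*m.2.1 + 4*m.2.2)
        * t₁ ^ ((m.1 : ℝ) + ν) * t₂ ^ ((m.2.1 : ℝ) - ν - d/2) * t₃ ^ m.2.2) /
      (poch (1 + ν) m.1 * poch (1 - ν - d/2) m.2.1 * poch 1 m.2.2 * poch (1 + ν) m.2.2
        * poch 1 (m.2.1 + 2*m.2.2)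
        * poch 1 (m.1 + 2*m.2.1 + 3*m.2.2)
        * poch (1 + ν) (m.1 + 2*m.2.1 + 3*m.2.2))

noncomputable def J21 (d μ t₁ t₂ : ℝ) : ℝ :=
  ∑' m : ℕ × ℕ,
    ((-1 : ℝ) ^ m.1 * t₁ ^ m.1 * t₂ ^ m.2) /
      (poch 1 m.1 * poch 1 m.2 * poch (1 + μ) m.2 * poch (1 + μ + d/2) (m.1 + 2*m.2))

noncomputable def J22 (d μ t₁ t₂ : ℝ) : ℝ :=
  ∑' m : ℕ × ℕ,
    ((-1 : ℝ) ^ m.1 * t₁ ^ ((m.1 : ℝ) - μ - d/2) * t₂ ^ m.2) /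
      (poch (1 - μ - d/2) m.1 * poch 1 m.2 * poch (1 + μ) m.2 * poch 1 (m.1 + 2*m.2))

def herm3 (a : Fin 3 → ℝ) (b : Fin 3 → ℂ) : Matrix (Fin 3) (Fin 3) ℂ :=
  !![(a 0 : ℂ), b 0, b 1;
     (starRingEnd ℂ) (b 0), (a 1 : ℂ), b 2;
     (starRingEnd ℂ) (b 1), (starRingEnd ℂ) (b 2), (a 2 : ℂ)]

theorem poch_one (n : ℕ) : poch 1 n = n.factorial := by
  rw [poch, ← Finset.prod_range_add_one_eq_factorial]
  push_cast
  exact Finset.prod_congr rfl fun i _ => add_comm _ _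

theorem abs_poch_le (a : ℝ) (n : ℕ) : |poch a n| ≤ (|a| + 1) ^ n * n.factorial := by
  rw [← poch_one, poch, poch, Finset.abs_prod, ← Finset.card_range n, ← Finset.prod_const,
    Finset.card_range, ← Finset.prod_mul_distrib]
  refine Finset.prod_le_prod (fun i _ => abs_nonneg _) fun i _ => ?_
  have hi : (0 : ℝ) ≤ i := Nat.cast_nonneg i
  have h := abs_add_le a i
  rw [abs_of_nonneg hi] at h
  nlinarith [mul_nonneg (abs_nonneg a) hi]

theorem exists_pos_mul_le_abs_add_natCast (a : ℝ) (h : ∀ i : ℕ, a + i ≠ 0) :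
    ∃ c > 0, ∀ i : ℕ, c * (1 + (i : ℝ)) ≤ |a + i| := by
  obtain ⟨N, hN⟩ := exists_nat_gt (2 * |a| + 1)
  have hfin : ∀ N : ℕ, ∃ c > (0 : ℝ), ∀ i < N, c * (1 + (i : ℝ)) ≤ |a + i| := by
    intro N
    induction N with
    | zero => exact ⟨1, one_pos, by simp⟩
    | succ k ih =>
      obtain ⟨c, hc, hle⟩ := ih
      have hk : (0 : ℝ) < 1 + k := by positivity
      refine ⟨min c (|a + k| / (1 + k)), lt_min hc (div_pos (abs_pos.2 (h k)) hk), fun i hi => ?_⟩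
      rcases Nat.lt_succ_iff_lt_or_eq.1 hi with hi | rfl
      · exact (mul_le_mul_of_nonneg_right (min_le_left _ _) (by positivity)).trans (hle i hi)
      · exact (le_div_iff₀ hk).1 (min_le_right _ _)
  obtain ⟨c, hc, hle⟩ := hfin N
  refine ⟨min c 4⁻¹, lt_min hc (by norm_num), fun i => ?_⟩
  rcases lt_or_ge i N with hi | hi
  · exact (mul_le_mul_of_nonneg_right (min_le_left _ _) (by positivity)).trans (hle i hi)
  · refine (mul_le_mul_of_nonneg_right (min_le_right _ _) (by positivity)).trans ?_
    have hi' : (N : ℝ) ≤ i := Nat.cast_le.2 hi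
    have := neg_abs_le a
    have := le_abs_self (a + i)
    have := abs_nonneg a
    linarith

theorem exists_pos_pow_mul_factorial_le_abs_poch (a : ℝ) (h : ∀ i : ℕ, a + i ≠ 0) :
    ∃ c > 0, ∀ n : ℕ, c ^ n * n.factorial ≤ |poch a n| := by
  obtain ⟨c, hc, hle⟩ := exists_pos_mul_le_abs_add_natCast a h
  refine ⟨c, hc, fun n => ?_⟩
  rw [← poch_one, poch, poch, Finset.abs_prod, ← Finset.card_range n, ← Finset.prod_const,
    Finset.card_range, ← Finset.prod_mul_distrib]
  exact Finset.prod_le_prod (fun i _ => by positivity) fun i _ => hle i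

theorem exists_pos_pow_le_abs_poch (a : ℝ) (h : ∀ i : ℕ, a + i ≠ 0) :
    ∃ c > 0, ∀ n : ℕ, c ^ n ≤ |poch a n| := by
  obtain ⟨c, hc, hle⟩ := exists_pos_pow_mul_factorial_le_abs_poch a h
  refine ⟨c, hc, fun n => le_trans ?_ (hle n)⟩
  exact le_mul_of_one_le_right (by positivity) (mod_cast n.factorial_pos)

theorem factorial_add_le (m n : ℕ) :
    ((m + n).factorial : ℝ) ≤ 2 ^ (m + n) * (m.factorial * n.factorial) := by
  rw [← Nat.add_choose_mul_factorial_mul_factorial m n, mul_assoc]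
  push_cast
  refine mul_le_mul_of_nonneg_right ?_ (by positivity)
  exact_mod_cast Nat.choose_le_two_pow (m + n) n

theorem dominating_term_eq {c₁ c₂ c₃ c₄ p q r F : ℝ} (hc₁ : c₁ ≠ 0) (hc₂ : c₂ ≠ 0)
    (hc₃ : c₃ ≠ 0) (hc₄ : c₄ ≠ 0) (hp : p ≠ 0) (hq : q ≠ 0) (hr : r ≠ 0) (hF : F ≠ 0)
    (K t₁ t₂ t₃ : ℝ) (k l m : ℕ) :
    K ^ (k + 2 * l + 4 * m) * (F * r) * t₁ ^ k * t₂ ^ l * t₃ ^ m /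
        (p * q * r * (c₁ ^ m * r) * c₂ ^ (l + 2 * m) * c₃ ^ (k + 2 * l + 3 * m)
          * (c₄ ^ (k + 2 * l + 3 * m) * F)) =
      (K * t₁ / (c₃ * c₄)) ^ k / p *
        ((K ^ 2 * t₂ / (c₂ * c₃ ^ 2 * c₄ ^ 2)) ^ l / q *
          ((K ^ 4 * t₃ / (c₁ * c₂ ^ 2 * c₃ ^ 3 * c₄ ^ 3)) ^ m / r)) := by
  simp only [pow_add, pow_mul, div_pow, mul_pow]
  simp only [← pow_mul]
  field_simp

theorem one_add_add_natCast_ne_zero {x : ℝ} (h : ∀ n : ℤ, n < 0 → x ≠ n) (i : ℕ) :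
    1 + x + i ≠ 0 := by
  intro hx
  refine h (-(i + 1)) (by omega) ?_
  push_cast
  linarith

theorem J31_summable (d ν : ℝ) (hd : 0 < d)
    (h1 : ∀ n : ℤ, n < 0 → ν ≠ n)
    (h2 : ∀ n : ℤ, n < 0 → ν + d/2 ≠ n)
    (h3 : ∀ n : ℤ, n < 0 → ν + d ≠ n)
    (h4 : ∀ n : ℤ, n < 0 → 2*ν + d ≠ n)
    (t₁ t₂ t₃ : ℝ) :
    Summable (fun m : ℕ × ℕ × ℕ =>
      |(poch (1 + 2*ν + d) (m.1 + 2*m.2.1 + 4*m.2.2)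
          * t₁ ^ m.1 * t₂ ^ m.2.1 * t₃ ^ m.2.2) /
        (poch 1 m.1 * poch 1 m.2.1 * poch 1 m.2.2 * poch (1 + ν) m.2.2
          * poch (1 + ν + d/2) (m.2.1 + 2*m.2.2)
          * poch (1 + ν + d) (m.1 + 2*m.2.1 + 3*m.2.2)
          * poch (1 + 2*ν + d) (m.1 + 2*m.2.1 + 3*m.2.2))|) := by
  have e2 := one_add_add_natCast_ne_zero h2
  have e3 := one_add_add_natCast_ne_zero h3
  have e4 := one_add_add_natCast_ne_zero h4
  rw [← add_assoc] at e2 e3 e4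
  obtain ⟨c₁, hc₁, hp₁⟩ := exists_pos_pow_mul_factorial_le_abs_poch _
    (one_add_add_natCast_ne_zero h1)
  obtain ⟨c₂, hc₂, hp₂⟩ := exists_pos_pow_le_abs_poch _ e2
  obtain ⟨c₃, hc₃, hp₃⟩ := exists_pos_pow_le_abs_poch _ e3
  obtain ⟨c₄, hc₄, hp₄⟩ := exists_pos_pow_mul_factorial_le_abs_poch _ e4
  have hup := abs_poch_le (1 + 2 * ν + d)
  set K : ℝ := |1 + 2 * ν + d| + 1
  have hK : 0 < K := by positivity
  have hs : Summable fun m : ℕ × ℕ × ℕ =>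
      (2 * K * |t₁| / (c₃ * c₄)) ^ m.1 / m.1.factorial *
        (((2 * K) ^ 2 * |t₂| / (c₂ * c₃ ^ 2 * c₄ ^ 2)) ^ m.2.1 / m.2.1.factorial *
          (((2 * K) ^ 4 * |t₃| / (c₁ * c₂ ^ 2 * c₃ ^ 3 * c₄ ^ 3)) ^ m.2.2 /
            m.2.2.factorial)) := by
    have h23 := (Real.summable_pow_div_factorial
      ((2 * K) ^ 2 * |t₂| / (c₂ * c₃ ^ 2 * c₄ ^ 2))).mul_of_nonneg
      (Real.summable_pow_div_factorial
        ((2 * K) ^ 4 * |t₃| / (c₁ * c₂ ^ 2 * c₃ ^ 3 * c₄ ^ 3)))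
      (fun n => by positivity) (fun n => by positivity)
    exact (Real.summable_pow_div_factorial (2 * K * |t₁| / (c₃ * c₄))).mul_of_nonneg h23
      (fun n => by positivity) (fun n => by positivity)
  refine hs.of_nonneg_of_le (fun _ => abs_nonneg _) ?_
  rintro ⟨k, l, m⟩
  simp only [abs_div, abs_mul, abs_pow, poch_one, Nat.abs_cast]
  have hnum : |poch (1 + 2 * ν + d) (k + 2 * l + 4 * m)| ≤
      (2 * K) ^ (k + 2 * l + 4 * m) * ((k + 2 * l + 3 * m).factorial * m.factorial) := by
    refine (hup _).trans ?_
    have h := factorial_add_le (k + 2 * l + 3 * m) m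
    rw [show k + 2 * l + 3 * m + m = k + 2 * l + 4 * m by ring] at h
    calc _ ≤ K ^ (k + 2 * l + 4 * m) * (2 ^ (k + 2 * l + 4 * m) *
          ((k + 2 * l + 3 * m).factorial * m.factorial)) := by gcongr
      _ = _ := by rw [mul_pow]; ring
  calc
    _ ≤ (2 * K) ^ (k + 2 * l + 4 * m) * ((k + 2 * l + 3 * m).factorial * m.factorial)
          * |t₁| ^ k * |t₂| ^ l * |t₃| ^ m /
        (k.factorial * l.factorial * m.factorial * (c₁ ^ m * m.factorial)
          * c₂ ^ (l + 2 * m) * c₃ ^ (k + 2 * l + 3 * m)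
          * (c₄ ^ (k + 2 * l + 3 * m) * (k + 2 * l + 3 * m).factorial)) := by
      gcongr
      · exact hp₁ m
      · exact hp₂ _
      · exact hp₃ _
      · exact hp₄ _
    _ = _ := dominating_term_eq hc₁.ne' hc₂.ne' hc₃.ne' hc₄.ne' (by positivity) (by positivity)
      (by positivity) (by positivity) ..
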